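/- There is a universal constant c > 0 such that for every n ≥ 5 there exists a simple graph G on n vertices with exactly 2n edges and girth at least c·log₂ n. -/

import Mathlib

open SimpleGraph Finset

/-- An acyclic graph on `n` vertices cannot have `2n` edges. -/
lemma aux_not_acyclic {n : ℕ} (hn : 5 ≤ n) (G : SimpleGraph (Fin n))
    (hE : G.edgeSet.ncard = 2 * n) : ¬ G.IsAcyclic := by
  classical
  intro hG
  have : Nonempty (Fin n) := ⟨⟨0, by omega⟩⟩
  obtain ⟨T, hGT, -, hT⟩ :=
    (connected_top (V := Fin n)).exists_isTree_le_of_le_of_isAcyclic le_top hG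
  have h1 := hT.card_edgeFinset
  have h2 : G.edgeFinset.card ≤ T.edgeFinset.card :=
    Finset.card_le_card (edgeFinset_mono hGT)
  rw [← coe_edgeFinset, Set.ncard_coe_finset] at hE
  simp at h1
  omega

/-- Vertices within distance `i` of `v`. -/
noncomputable def auxBall {V : Type*} [Fintype V] [DecidableEq V] (G : SimpleGraph V)
    [DecidableRel G.Adj] : ℕ → V → Finset V
  | 0, v => {v}
  | i + 1, v => insert v ((G.neighborFinset v).biUnion (auxBall G i))

lemma auxBall_card {V : Type*} [Fintype V] [DecidableEq V] (G : SimpleGraph V)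
    [DecidableRel G.Adj] (hd : ∀ v, G.degree v ≤ 5) (i : ℕ) (v : V) :
    (auxBall G i v).card ≤ 6 ^ i := by
  induction i generalizing v with
  | zero => simp [auxBall]
  | succ i ih =>
    have h1 : ((G.neighborFinset v).biUnion (auxBall G i)).card ≤ G.degree v * 6 ^ i :=
      Finset.card_biUnion_le_card_mul _ _ _ (fun x _ => ih x)
    have h2 := Finset.card_insert_le v ((G.neighborFinset v).biUnion (auxBall G i))
    have h3 : G.degree v * 6 ^ i ≤ 5 * 6 ^ i := Nat.mul_le_mul_right _ (hd v)
    have h4 : 0 < 6 ^ i := by positivity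
    rw [auxBall, pow_succ]
    omega

lemma auxBall_mem {V : Type*} [Fintype V] [DecidableEq V] (G : SimpleGraph V)
    [DecidableRel G.Adj] {v u : V} (p : G.Walk v u) (i : ℕ) (hi : p.length ≤ i) :
    u ∈ auxBall G i v := by
  induction p generalizing i with
  | nil => cases i <;> simp [auxBall]
  | cons h p ih =>
    cases i with
    | zero => simp at hi
    | succ i =>
      simp only [Walk.length_cons, Nat.add_le_add_iff_right] at hi
      rw [auxBall]
      refine Finset.mem_insert_of_mem (Finset.mem_biUnion.2 ⟨_, ?_, ih i hi⟩)
      simpa using h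

lemma aux_split {V : Type*} {G : SimpleGraph V} {a b : V} (p : G.Walk a b) (e : Sym2 V)
    (he : e ∈ p.edges) :
    ∃ (x y : V) (h : G.Adj x y) (q : G.Walk a x) (r : G.Walk y b),
      s(x, y) = e ∧ p = q.append (Walk.cons h r) := by
  induction p with
  | nil => simp at he
  | @cons u v w h p ih =>
    rw [Walk.edges_cons, List.mem_cons] at he
    rcases he with he | he
    · exact ⟨_, _, h, Walk.nil, p, he.symm, rfl⟩
    · obtain ⟨x, y, h', q, r, h1, h2⟩ := ih he
      exact ⟨x, y, h', Walk.cons h q, r, h1, by simp [h2]⟩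

/-- Adding an edge between far apart vertices keeps the girth large. -/
lemma aux_girth {V : Type*} (G : SimpleGraph V) (u v : V) (g : ℕ)
    (hG : ∀ a (w : G.Walk a a), w.IsCycle → g ≤ w.length)
    (hfar : ∀ p : G.Walk v u, g < p.length) :
    ∀ a (w : (G ⊔ edge u v).Walk a a), w.IsCycle → g ≤ w.length := by
  intro a w hw
  have key : ∀ e ∈ (G ⊔ edge u v).edgeSet, e ≠ s(u, v) → e ∈ G.edgeSet := by
    intro e he hne
    rw [edgeSet_sup] at he
    rcases he with he | he
    · exact he
    · exact absurd (edgeSet_edge_subset he) hne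
  by_cases he : s(u, v) ∈ w.edges
  · obtain ⟨x, y, h, q, r, hxy, rfl⟩ := aux_split w _ he
    have hnd := hw.isTrail.edges_nodup
    rw [Walk.edges_append, Walk.edges_cons, List.nodup_append] at hnd
    obtain ⟨-, h2, h3⟩ := hnd
    rw [List.nodup_cons] at h2
    have hne : ∀ e ∈ (r.append q).edges, e ∈ G.edgeSet := by
      intro e he'
      refine key e (Walk.edges_subset_edgeSet _ he') ?_
      rintro rfl
      rw [Walk.edges_append, List.mem_append] at he'
      rcases he' with he' | he'
      · exact h2.1 (hxy ▸ he')
      · exact h3 _ he' s(x, y) (by simp) hxy.symm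
    have hlen := Walk.length_transfer (r.append q) hne
    have : g < (r.append q).length := by
      rw [← hlen]
      rcases Sym2.eq_iff.1 hxy with ⟨rfl, rfl⟩ | ⟨rfl, rfl⟩
      · exact hfar _
      · rw [← Walk.length_reverse]
        exact hfar _
    simp only [Walk.length_append, Walk.length_cons] at this ⊢
    omega
  · have hne : ∀ e ∈ w.edges, e ∈ G.edgeSet := fun e he' =>
      key e (Walk.edges_subset_edgeSet _ he') (fun h => he (h ▸ he'))
    have := hG a _ (hw.transfer hne)
    rwa [Walk.length_transfer] at this

lemma aux_degree {V : Type*} [Fintype V] [DecidableEq V] (G : SimpleGraph V)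
    [DecidableRel G.Adj] (u v : V) [DecidableRel (G ⊔ edge u v).Adj]
    (hd : ∀ v, G.degree v ≤ 5) (hu : G.degree u < 5) (hv : G.degree v < 5) (x : V) :
    (G ⊔ edge u v).degree x ≤ 5 := by
  have hx := hd x
  by_cases hxu : x = u
  · subst hxu
    have : (G ⊔ edge x v).neighborFinset x ⊆ insert v (G.neighborFinset x) := by
      intro y hy
      simp only [mem_neighborFinset, sup_adj, edge_adj, Finset.mem_insert] at hy ⊢
      grind
    have h1 := Finset.card_le_card this
    have h2 := Finset.card_insert_le v (G.neighborFinset x)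
    simp only [card_neighborFinset_eq_degree] at h1 h2
    omega
  · by_cases hxv : x = v
    · subst hxv
      have : (G ⊔ edge u x).neighborFinset x ⊆ insert u (G.neighborFinset x) := by
        intro y hy
        simp only [mem_neighborFinset, sup_adj, edge_adj, Finset.mem_insert] at hy ⊢
        grind
      have h1 := Finset.card_le_card this
      have h2 := Finset.card_insert_le u (G.neighborFinset x)
      simp only [card_neighborFinset_eq_degree] at h1 h2
      omega
    · have : (G ⊔ edge u v).neighborFinset x ⊆ G.neighborFinset x := by
        intro y hy
        simp only [mem_neighborFinset, sup_adj, edge_adj] at hy ⊢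
        grind
      have h1 := Finset.card_le_card this
      simp only [card_neighborFinset_eq_degree] at h1
      omega

open scoped Classical in
lemma aux_main (n g : ℕ) (hg1 : 1 ≤ g) (h : 5 * 6 ^ g ≤ n) :
    ∃ G : SimpleGraph (Fin n), G.edgeFinset.card = 2 * n ∧
      ∀ a (w : G.Walk a a), w.IsCycle → g ≤ w.length := by
  let P : SimpleGraph (Fin n) → Prop := fun G =>
    G.edgeFinset.card ≤ 2 * n ∧ (∀ v, G.degree v ≤ 5) ∧
      ∀ a (w : G.Walk a a), w.IsCycle → g ≤ w.length
  have hbot : P ⊥ := by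
    refine ⟨?_, fun v => ?_, fun a w hw => ?_⟩
    · have h0 : (⊥ : SimpleGraph (Fin n)).edgeFinset.card = 0 := by
        rw [Finset.card_eq_zero, edgeFinset_eq_empty]
      exact le_of_eq_of_le (by convert h0) (Nat.zero_le _)
    · have h0 : (⊥ : SimpleGraph (Fin n)).degree v = 0 := by
        rw [← card_neighborFinset_eq_degree, Finset.card_eq_zero]
        ext y
        simp
      exact le_of_eq_of_le (by convert h0) (Nat.zero_le _)
    exact absurd hw (isAcyclic_bot w)
  obtain ⟨G, hmax⟩ := Set.Finite.exists_maximal (Set.toFinite {G | P G}) ⟨⊥, hbot⟩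
  obtain ⟨hE, hd, hg⟩ : P G := hmax.prop
  refine ⟨G, ?_, hg⟩
  by_contra hne
  have hlt : G.edgeFinset.card < 2 * n := by omega
  set S : Finset (Fin n) := univ.filter (fun v => G.degree v < 5) with hS
  have hcard : n < 5 * S.card := by
    have h1 := G.sum_degrees_eq_twice_card_edges
    have h2 : ∑ v : Fin n, 5 ≤ ∑ v : Fin n, (G.degree v + if G.degree v < 5 then 5 else 0) := by
      refine Finset.sum_le_sum fun v _ => ?_
      split_ifs <;> omega
    rw [Finset.sum_add_distrib, h1, ← Finset.sum_filter] at h2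
    simp only [Finset.sum_const, smul_eq_mul, card_univ, Fintype.card_fin] at h2
    rw [← hS] at h2
    omega
  obtain ⟨v, hv⟩ : S.Nonempty := by
    rw [← Finset.card_pos]; omega
  have hb := auxBall_card G hd g v
  obtain ⟨u, hu, hub⟩ := Finset.exists_mem_notMem_of_card_lt_card
    (s := auxBall G g v) (t := S) (by omega)
  have hfar : ∀ p : G.Walk v u, g < p.length := by
    intro p
    by_contra hp
    exact hub (auxBall_mem G p g (by omega))
  have huv : u ≠ v := by
    rintro rfl
    exact absurd (hfar Walk.nil) (by simp)
  have hnadj : ¬ G.Adj u v := by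
    intro hadj
    have h1 := hfar (Walk.cons hadj.symm Walk.nil)
    simp at h1
    omega
  have hP : P (G ⊔ edge u v) := by
    refine ⟨?_, ?_, aux_girth G u v g hg hfar⟩
    · have h1 := card_edgeFinset_sup_edge G hnadj huv
      have h2 : G.edgeFinset.card + 1 ≤ 2 * n := hlt
      rw [← h1] at h2
      convert h2
    · intro x
      convert aux_degree G u v hd (by simpa [hS] using hu) (by simpa [hS] using hv) x
  exact (lt_sup_edge G _ _ huv hnadj).not_ge (hmax.le_of_ge hP le_sup_left)

/-- for every `n ≥ 5` there exists a simple graph on `n` vertices with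
exactly `2n` edges and girth at least `c·log₂ n`. -/
theorem graph_two_n_edges_log_girth :
    ∃ c : ℝ, 0 < c ∧
      ∀ n : ℕ, 5 ≤ n →
      ∃ G : SimpleGraph (Fin n),
        G.edgeSet.ncard = 2 * n ∧
        ∀ g : ℕ, G.girth = (g : ℕ∞) → c * Real.logb 2 n ≤ (g : ℝ) := by
  classical
  refine ⟨1 / 9, by norm_num, fun n hn => ?_⟩
  have hlog : ∀ k : ℕ, n ≤ 6 ^ k → Real.logb 2 n ≤ 3 * k := by
    intro k hk
    have hn0 : (0 : ℝ) < n := by exact_mod_cast (by omega : 0 < n)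
    rw [Real.logb_le_iff_le_rpow (by norm_num) hn0]
    have h1 : (n : ℝ) ≤ 8 ^ k := by
      have : (n : ℝ) ≤ 6 ^ k := by exact_mod_cast hk
      exact this.trans (by gcongr; norm_num)
    refine h1.trans (le_of_eq ?_)
    rw [show (3 * (k : ℝ)) = ((3 * k : ℕ) : ℝ) by push_cast; ring, Real.rpow_natCast, pow_mul]
    norm_num
  by_cases hsmall : n < 30
  · have hc : 2 * n ≤ (⊤ : SimpleGraph (Fin n)).edgeFinset.card := by
      rw [card_edgeFinset_top_eq_card_choose_two, Fintype.card_fin, Nat.choose_two_right,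
        Nat.le_div_iff_mul_le (by norm_num)]
      obtain ⟨m, rfl⟩ : ∃ m, n = m + 5 := ⟨n - 5, by omega⟩
      rw [show m + 5 - 1 = m + 4 by omega]
      nlinarith
    obtain ⟨E, hE, hEc⟩ := Finset.exists_subset_card_eq hc
    have hes : (fromEdgeSet (E : Set (Sym2 (Fin n)))).edgeSet = E := by
      rw [edgeSet_fromEdgeSet, sdiff_eq_left, Set.disjoint_left]
      intro e he
      have := hE he
      rw [mem_edgeFinset] at this
      exact not_isDiag_of_mem_edgeSet _ this
    have hcard : (fromEdgeSet (E : Set (Sym2 (Fin n)))).edgeSet.ncard = 2 * n := by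
      rw [hes, Set.ncard_coe_finset, hEc]
    refine ⟨_, hcard, fun g hg => ?_⟩
    have h3 := three_le_girth (aux_not_acyclic hn _ hcard)
    have hg' : (fromEdgeSet (E : Set (Sym2 (Fin n)))).girth = g := by exact_mod_cast hg
    rw [hg'] at h3
    have h3' : (3 : ℝ) ≤ g := by exact_mod_cast h3
    have := hlog 2 (by omega)
    push_cast at this
    linarith
  · set k := Nat.log 6 (n / 5) with hk
    have h5 : n / 5 ≠ 0 := by omega
    have hk1 : 6 ^ k ≤ n / 5 := Nat.pow_log_le_self 6 h5
    have hk2 : n / 5 < 6 ^ (k + 1) := Nat.lt_pow_succ_log_self (by norm_num) _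
    have hk0 : 1 ≤ k := Nat.le_log_of_pow_le (by norm_num) (by omega)
    obtain ⟨G, hE, hG⟩ := aux_main n k hk0 (by omega)
    have hcard : G.edgeSet.ncard = 2 * n := by
      rw [← coe_edgeFinset, Set.ncard_coe_finset, hE]
    refine ⟨G, hcard, fun g hg => ?_⟩
    have hg' : G.girth = g := by exact_mod_cast hg
    obtain ⟨a, w, hw, hwl⟩ := exists_girth_eq_length.2 (aux_not_acyclic hn G hcard)
    have hkg : k ≤ g := by
      rw [← hg', hwl]; exact hG a w hw
    have hl := hlog (k + 2) (by rw [pow_succ]; omega)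
    have hkg' : (k : ℝ) ≤ g := by exact_mod_cast hkg
    have hk0' : (1 : ℝ) ≤ k := by exact_mod_cast hk0
    push_cast at hl
    linarith
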